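/- The matrices M and M̃ defined from the state-space data as above are invertible over K = RatFunc ℝ, and M̃⁻¹ * Ñ = N * M⁻¹ = C * (z•1 − A)⁻¹ * B; that is, (Ñ, M̃) is a left fractional representation and (N, M) is a right fractional representation of the plant transfer matrix G(z) = C(zI − A)⁻¹B. -/

import Mathlib

open Matrix

set_option synthInstance.maxHeartbeats 400000

noncomputable section

open Polynomial in
/-- The pencil `zI - A` of a matrix with entries in a field is invertible over the rational
functions, since its determinant is the characteristic polynomial. -/
theorem isUnit_X_smul_one_sub_map {k ι : Type*} [Field k] [Fintype ι] [DecidableEq ι]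
    (A : Matrix ι ι k) :
    IsUnit ((RatFunc.X : RatFunc k) • (1 : Matrix ι ι (RatFunc k)) -
      A.map (algebraMap k (RatFunc k))) := by
  have h : (RatFunc.X : RatFunc k) • (1 : Matrix ι ι (RatFunc k)) -
      A.map (algebraMap k (RatFunc k)) = (algebraMap k[X] (RatFunc k)).mapMatrix A.charmatrix := by
    ext i j
    by_cases hij : i = j
    · subst hij
      simp [RatFunc.algebraMap_eq_C]
    · simp [hij, RatFunc.algebraMap_eq_C]
  rw [h, Matrix.isUnit_iff_isUnit_det, ← RingHom.map_det, isUnit_iff_ne_zero]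
  exact (map_ne_zero_iff _ (RatFunc.algebraMap_injective k)).2 A.charpoly_monic.ne_zero

section Feedback

variable {R ι κ l : Type*} [CommRing R] [Fintype ι] [DecidableEq ι]

theorem inv_mul_sub_mul_inv {P Q : Matrix ι ι R} (hP : IsUnit P) (hQ : IsUnit Q) :
    Q⁻¹ * (P - Q) * P⁻¹ = Q⁻¹ - P⁻¹ := by
  rw [Matrix.isUnit_iff_isUnit_det] at hP hQ
  rw [Matrix.mul_sub, Matrix.nonsing_inv_mul _ hQ, Matrix.sub_mul, Matrix.one_mul,
    Matrix.mul_nonsing_inv_cancel_right _ _ hP]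

variable [Fintype κ] [DecidableEq κ]

theorem isUnit_one_add_mul_inv_mul {P Q : Matrix ι ι R} {B : Matrix ι κ R} {F : Matrix κ ι R}
    (hP : IsUnit P) (hQ : IsUnit Q) (h : B * F = P - Q) : IsUnit (1 + F * Q⁻¹ * B) := by
  have key : F * Q⁻¹ * B * (F * P⁻¹ * B) = F * Q⁻¹ * B - F * P⁻¹ * B :=
    calc F * Q⁻¹ * B * (F * P⁻¹ * B) = F * (Q⁻¹ * (B * F) * P⁻¹) * B := by
          simp only [Matrix.mul_assoc]
      _ = _ := by rw [h, inv_mul_sub_mul_inv hP hQ, Matrix.mul_sub, Matrix.sub_mul]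
  refine IsUnit.of_mul_eq_one (1 - F * P⁻¹ * B) ?_
  rw [Matrix.mul_sub, Matrix.mul_one, Matrix.add_mul, Matrix.one_mul, key]
  abel

theorem mul_inv_one_add_mul_inv_mul {P Q : Matrix ι ι R} {B : Matrix ι κ R} {F : Matrix κ ι R}
    (C : Matrix l ι R) (hP : IsUnit P) (hQ : IsUnit Q) (h : B * F = P - Q) :
    C * Q⁻¹ * B * (1 + F * Q⁻¹ * B)⁻¹ = C * P⁻¹ * B := by
  have hM := (Matrix.isUnit_iff_isUnit_det _).1 (isUnit_one_add_mul_inv_mul hP hQ h)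
  have hinv : P⁻¹ * (B * F) * Q⁻¹ = Q⁻¹ - P⁻¹ := by
    rw [h, ← neg_sub Q P, Matrix.mul_neg, Matrix.neg_mul, inv_mul_sub_mul_inv hQ hP, neg_sub]
  have key : C * Q⁻¹ * B = C * P⁻¹ * B * (1 + F * Q⁻¹ * B) := by
    symm
    calc C * P⁻¹ * B * (1 + F * Q⁻¹ * B)
        = C * P⁻¹ * B + C * (P⁻¹ * (B * F) * Q⁻¹) * B := by
          simp only [Matrix.mul_add, Matrix.mul_one, Matrix.mul_assoc]
      _ = C * Q⁻¹ * B := by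
          rw [hinv, Matrix.mul_sub, Matrix.sub_mul]
          abel
  rw [key, Matrix.mul_nonsing_inv_cancel_right _ _ hM]

theorem inv_one_add_mul_inv_mul_mul {P Q : Matrix ι ι R} {L : Matrix ι κ R} {C : Matrix κ ι R}
    (B : Matrix ι l R) (hP : IsUnit P) (hQ : IsUnit Q) (h : L * C = P - Q) :
    (1 + C * Q⁻¹ * L)⁻¹ * (C * Q⁻¹ * B) = C * P⁻¹ * B := by
  have hM := (Matrix.isUnit_iff_isUnit_det _).1 (isUnit_one_add_mul_inv_mul hP hQ h)
  have key : C * Q⁻¹ * B = (1 + C * Q⁻¹ * L) * (C * P⁻¹ * B) := by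
    symm
    calc (1 + C * Q⁻¹ * L) * (C * P⁻¹ * B)
        = C * P⁻¹ * B + C * (Q⁻¹ * (L * C) * P⁻¹) * B := by
          simp only [Matrix.add_mul, Matrix.one_mul, Matrix.mul_assoc]
      _ = C * Q⁻¹ * B := by
          rw [h, inv_mul_sub_mul_inv hP hQ, Matrix.mul_sub, Matrix.sub_mul]
          abel
  rw [key, Matrix.nonsing_inv_mul_cancel_left _ _ hM]

end Feedback

/-- `(Ñ, M̃)` is a left fractional representation and `(N, M)` a right fractional
representation of the plant transfer matrix `G(z) = C (zI - A)⁻¹ B`. -/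
theorem coprime_factors_represent_plant (n m p : ℕ)
    (A : Matrix (Fin n) (Fin n) ℝ) (B : Matrix (Fin n) (Fin m) ℝ)
    (C : Matrix (Fin p) (Fin n) ℝ) (F : Matrix (Fin m) (Fin n) ℝ)
    (L : Matrix (Fin n) (Fin p) ℝ) :
    let z : RatFunc ℝ := RatFunc.X
    let A' := A.map (algebraMap ℝ (RatFunc ℝ))
    let B' := B.map (algebraMap ℝ (RatFunc ℝ))
    let C' := C.map (algebraMap ℝ (RatFunc ℝ))
    let F' := F.map (algebraMap ℝ (RatFunc ℝ))
    let L' := L.map (algebraMap ℝ (RatFunc ℝ))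
    let AF := A' + B' * F'
    let AL := A' - L' * C'
    let RF := (z • (1 : Matrix (Fin n) (Fin n) (RatFunc ℝ)) - AF)⁻¹
    let RL := (z • (1 : Matrix (Fin n) (Fin n) (RatFunc ℝ)) - AL)⁻¹
    let M := (1 : Matrix (Fin m) (Fin m) (RatFunc ℝ)) + F' * RF * B'
    let N := C' * RF * B'
    let Mt := (1 : Matrix (Fin p) (Fin p) (RatFunc ℝ)) - C' * RL * L'
    let Nt := C' * RL * B'
    let G := C' * (z • (1 : Matrix (Fin n) (Fin n) (RatFunc ℝ)) - A')⁻¹ * B'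
    IsUnit M ∧ IsUnit Mt ∧ Mt⁻¹ * Nt = G ∧ N * M⁻¹ = G := by
  intro z A' B' C' F' L' AF AL RF RL M N Mt Nt G
  have hP : IsUnit (z • 1 - A') := isUnit_X_smul_one_sub_map A
  have hF : IsUnit (z • 1 - AF) := by
    simpa only [Matrix.map_add _ (map_add _), Matrix.map_mul]
      using isUnit_X_smul_one_sub_map (A + B * F)
  have hL : IsUnit (z • 1 - AL) := by
    simpa only [Matrix.map_sub _ (map_sub _), Matrix.map_mul]
      using isUnit_X_smul_one_sub_map (A - L * C)
  have hBF : B' * F' = (z • 1 - A') - (z • 1 - AF) := by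
    simp only [AF]
    abel
  have hLC : (-L') * C' = (z • 1 - A') - (z • 1 - AL) := by
    simp only [AL, Matrix.neg_mul]
    abel
  have hMt : Mt = 1 + C' * RL * (-L') := by
    rw [Matrix.mul_neg, ← sub_eq_add_neg]
  refine ⟨isUnit_one_add_mul_inv_mul hP hF hBF, ?_, ?_, mul_inv_one_add_mul_inv_mul C' hP hF hBF⟩
  · rw [hMt]
    exact isUnit_one_add_mul_inv_mul hP hL hLC
  · rw [hMt]
    exact inv_one_add_mul_inv_mul_mul B' hP hL hLC
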